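/- arXiv:2011.12496 — 3 statements merged into one kernel-verified Lean document; each statement's English description precedes it below -/
import Mathlib

section
/- Under the stated setup, let 𝒞 be a connected component of G[S] that contains no D-pair. Then f(V(𝒞)) ≥ 3|V(𝒞)|/4. -/
open Finset

/-- `m` encodes a perfect matching of the induced subgraph `G[S]`:
every vertex of `S` is matched to a distinct adjacent vertex of `S`. -/
def IsMatchingOn {V : Type*} (G : SimpleGraph V) (S : Finset V) (m : V → V) : Prop :=
  ∀ u ∈ S, m u ∈ S ∧ m u ≠ u ∧ G.Adj u (m u) ∧ m (m u) = u

/-- `S` is a paired dominating set of `G`: a dominating set such that `G[S]`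
has a perfect matching. -/
def IsPDS {V : Type*} (G : SimpleGraph V) (S : Finset V) : Prop :=
  (∀ v : V, v ∉ S → ∃ u ∈ S, G.Adj v u) ∧ ∃ m : V → V, IsMatchingOn G S m

/-- The paired domination number of `G`. -/
noncomputable def gammaPr {V : Type*} (G : SimpleGraph V) : ℕ :=
  sInf {k : ℕ | ∃ S : Finset V, IsPDS G S ∧ S.card = k}

/-- `N_S(x)`, the set of neighbours of `x` inside `S`. -/
def nbrS {V : Type*} [DecidableEq V] (G : SimpleGraph V) [DecidableRel G.Adj]
    (S : Finset V) (x : V) : Finset V :=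
  S.filter (fun u => G.Adj x u)

/-- `λ(S)`: (twice) the number of edges of `G[S]` (each edge counted in both directions). -/
def lambdaS {V : Type*} [DecidableEq V] (G : SimpleGraph V) [DecidableRel G.Adj]
    (S : Finset V) : ℕ :=
  ((S ×ˢ S).filter (fun p => G.Adj p.1 p.2)).card

/-- The private neighbours of `u ∈ S`: vertices outside `S` whose unique
neighbour in `S` is `u`. -/
def privates {V : Type*} [Fintype V] [DecidableEq V] (G : SimpleGraph V) [DecidableRel G.Adj]
    (S : Finset V) (u : V) : Finset V :=
  Finset.univ.filter (fun x => x ∉ S ∧ nbrS G S x = {u})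

/-- `A = {v ∈ S : v and v̄ together have at least two private neighbours}`. -/
def setA {V : Type*} [Fintype V] [DecidableEq V] (G : SimpleGraph V) [DecidableRel G.Adj]
    (S : Finset V) (m : V → V) : Finset V :=
  S.filter (fun v => 2 ≤ (privates G S v).card + (privates G S (m v)).card)

/-- `B = {v ∈ S : v has a private neighbour and v̄ has none}`. -/
def setB {V : Type*} [Fintype V] [DecidableEq V] (G : SimpleGraph V) [DecidableRel G.Adj]
    (S : Finset V) (m : V → V) : Finset V :=
  S.filter (fun v => (privates G S v).Nonempty ∧ privates G S (m v) = ∅)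

/-- `C = {v ∈ S : v̄ ∈ B}`. -/
def setC {V : Type*} [Fintype V] [DecidableEq V] (G : SimpleGraph V) [DecidableRel G.Adj]
    (S : Finset V) (m : V → V) : Finset V :=
  S.filter (fun v => m v ∈ setB G S m)

/-- `D = {v ∈ S : neither v nor v̄ has a private neighbour}`. -/
def setD {V : Type*} [Fintype V] [DecidableEq V] (G : SimpleGraph V) [DecidableRel G.Adj]
    (S : Finset V) (m : V → V) : Finset V :=
  S.filter (fun v => privates G S v = ∅ ∧ privates G S (m v) = ∅)

/-- The weight `f(xu)` of an edge `xu` with `x ∈ V∖S` and `u ∈ S`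
(`0` on non-edges and on pairs not of this form). -/
def fwt {V : Type*} [Fintype V] [DecidableEq V] (G : SimpleGraph V) [DecidableRel G.Adj]
    (S : Finset V) (m : V → V) (x u : V) : ℚ :=
  if x ∈ S ∨ u ∉ S ∨ ¬ G.Adj x u then 0
  else if nbrS G S x = {u} then 1
  else if nbrS G S x ⊆ setA G S m ∨ nbrS G S x ⊆ setB G S m ∪ setC G S m ∨
      nbrS G S x ⊆ setD G S m then
    1 / ((nbrS G S x).card : ℚ)
  else if u ∈ setA G S m then 0
  else if nbrS G S x ∩ setD G S m = ∅ then
    1 / (((nbrS G S x ∩ (setB G S m ∪ setC G S m))).card : ℚ)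
  else if u ∈ setB G S m ∪ setC G S m then 1 / 6
  else (1 - ((nbrS G S x ∩ (setB G S m ∪ setC G S m)).card : ℚ) / 6) /
      ((nbrS G S x ∩ setD G S m).card : ℚ)

/-- `f(S')`: total weight of the edges between `S' ⊆ S` and `V∖S`. -/
def fsum {V : Type*} [Fintype V] [DecidableEq V] (G : SimpleGraph V) [DecidableRel G.Adj]
    (S : Finset V) (m : V → V) (T : Finset V) : ℚ :=
  ∑ u ∈ T, ∑ x ∈ Finset.univ \ S, fwt G S m x u

/-- `C` is (the vertex set of) a connected component of `G[S]`. -/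
def IsComponent {V : Type*} [DecidableEq V] (G : SimpleGraph V) [DecidableRel G.Adj]
    (S C : Finset V) : Prop :=
  C ⊆ S ∧ C.Nonempty ∧ (G.induce (↑C : Set V)).Connected ∧
    ∀ u ∈ C, ∀ v ∈ S, G.Adj u v → v ∈ C

/-- `S_u = {u, m u}` is a `D`-pair. -/
def IsDPair {V : Type*} [Fintype V] [DecidableEq V] (G : SimpleGraph V) [DecidableRel G.Adj]
    (S : Finset V) (m : V → V) (u : V) : Prop :=
  u ∈ setD G S m ∧ m u ∈ setD G S m

/-- `S_u = {u, m u}` is an `A`-pair. -/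
def IsAPair {V : Type*} [Fintype V] [DecidableEq V] (G : SimpleGraph V) [DecidableRel G.Adj]
    (S : Finset V) (m : V → V) (u : V) : Prop :=
  u ∈ setA G S m ∧ m u ∈ setA G S m

/-- `S_u = {u, m u}` is a `BC`-pair. -/
def IsBCPair {V : Type*} [Fintype V] [DecidableEq V] (G : SimpleGraph V) [DecidableRel G.Adj]
    (S : Finset V) (m : V → V) (u : V) : Prop :=
  (u ∈ setB G S m ∧ m u ∈ setC G S m) ∨ (u ∈ setC G S m ∧ m u ∈ setB G S m)

/-- `u` is a leaf of `G[S]`: it has exactly one neighbour in `S`. -/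
def IsLeaf {V : Type*} [DecidableEq V] (G : SimpleGraph V) [DecidableRel G.Adj]
    (S : Finset V) (u : V) : Prop :=
  (nbrS G S u).card = 1

/-- `S_u` is a solo pair: both `u` and `m u` are leaves of `G[S]`. -/
def IsSoloPair {V : Type*} [DecidableEq V] (G : SimpleGraph V) [DecidableRel G.Adj]
    (S : Finset V) (m : V → V) (u : V) : Prop :=
  IsLeaf G S u ∧ IsLeaf G S (m u)

/-- The component `C` of `G[S]` contains no linked `D`-pairs: no edge of `G[S]`
joins vertices of two distinct `D`-pairs. -/
def NoLinkedDPairs {V : Type*} [Fintype V] [DecidableEq V] (G : SimpleGraph V)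
    [DecidableRel G.Adj] (S : Finset V) (m : V → V) (C : Finset V) : Prop :=
  ∀ u ∈ C, ∀ v ∈ C, u ∈ setD G S m → v ∈ setD G S m → v ≠ u → v ≠ m u → ¬ G.Adj u v

/-- `{w₁, w₂}` is a constraint pair of the solo `D`-pair `S_u`. -/
def ConstraintPair {V : Type*} [Fintype V] [DecidableEq V] (G : SimpleGraph V)
    [DecidableRel G.Adj] (S : Finset V) (m : V → V) (u w₁ w₂ : V) : Prop :=
  ∃ x y : V, x ∉ S ∧ y ∉ S ∧ G.Adj u y ∧ G.Adj (m u) x ∧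
    G.Adj x w₁ ∧ G.Adj y w₂ ∧ w₁ ∈ setD G S m ∧ w₂ ∈ setD G S m ∧
    w₁ ≠ w₂ ∧ m w₁ ≠ w₂

/-- The pairs `S_u` and `S_v` are adjacent: some vertex of one is adjacent
to some vertex of the other. -/
def PairAdj {V : Type*} (G : SimpleGraph V) (m : V → V) (u v : V) : Prop :=
  G.Adj u v ∨ G.Adj u (m v) ∨ G.Adj (m u) v ∨ G.Adj (m u) (m v)

/-- The Petersen graph, as the Kneser graph on 2-element subsets of a
5-element set, two subsets being adjacent iff they are disjoint. -/
def petersenGraph : SimpleGraph {s : Finset (Fin 5) // s.card = 2} where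
  Adj a b := Disjoint (a : Finset (Fin 5)) (b : Finset (Fin 5))
  symm := ⟨fun _ _ h => h.symm⟩
  loopless := by
    refine ⟨?_⟩
    intro a h
    rw [disjoint_self] at h
    have h2 := a.2
    rw [h] at h2
    simp at h2

section Helpers

variable {V : Type*} [Fintype V] [DecidableEq V] (G : SimpleGraph V) [DecidableRel G.Adj]

lemma lambdaS_insert_aux (T : Finset V) (x : V) (hx : x ∉ T) :
    lambdaS G (insert x T) = lambdaS G T + 2 * (nbrS G T x).card := by
  have key : ∀ U : Finset V,
      lambdaS G U = ∑ a ∈ U, ∑ b ∈ U, if G.Adj a b then 1 else 0 := by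
    intro U
    unfold lambdaS
    rw [Finset.card_filter, Finset.sum_product]
  have h1 : (nbrS G T x).card = ∑ b ∈ T, if G.Adj x b then 1 else 0 := by
    unfold nbrS
    rw [Finset.card_filter]
  have h2 : (nbrS G T x).card = ∑ b ∈ T, if G.Adj b x then 1 else 0 := by
    rw [h1]
    apply Finset.sum_congr rfl
    intro b _
    simp [G.adj_comm]
  rw [key, key, Finset.sum_insert hx, Finset.sum_insert hx]
  simp only [SimpleGraph.irrefl, if_false]
  have h3 : ∑ a ∈ T, ∑ b ∈ insert x T, (if G.Adj a b then 1 else 0)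
      = ∑ a ∈ T, ((if G.Adj a x then 1 else 0) + ∑ b ∈ T, if G.Adj a b then 1 else 0) := by
    apply Finset.sum_congr rfl
    intro a _
    rw [Finset.sum_insert hx]
  rw [h3, Finset.sum_add_distrib, ← h1, ← h2]
  omega

lemma mem_privates_aux (S : Finset V) (u x : V) :
    x ∈ privates G S u ↔ x ∉ S ∧ nbrS G S x = {u} := by
  simp [privates]

lemma mem_nbrS_aux (S : Finset V) (x u : V) : u ∈ nbrS G S x ↔ u ∈ S ∧ G.Adj x u := by
  simp [nbrS]

/-- The mate of a vertex of `B` is a leaf. -/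
lemma leaf_aux (S : Finset V) (m : V → V)
    (hdom : ∀ v : V, v ∉ S → ∃ u ∈ S, G.Adj v u)
    (hmatch : IsMatchingOn G S m)
    (hP1 : ∀ T : Finset V, IsPDS G T → T.card = S.card → lambdaS G S ≤ lambdaS G T)
    (u : V) (hu : u ∈ S) (hp : (privates G S u).Nonempty) (hq : privates G S (m u) = ∅) :
    (nbrS G S (m u)).card ≤ 1 := by
  obtain ⟨x, hx⟩ := hp
  rw [mem_privates_aux] at hx
  obtain ⟨hxS, hxN⟩ := hx
  obtain ⟨hmS, hmne, hadj, hmm⟩ := hmatch u hu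
  have hxu : G.Adj x u := ((mem_nbrS_aux G S x u).1 (by rw [hxN]; simp)).2
  have hxnu : x ≠ u := fun h => hxS (h ▸ hu)
  have hxT : x ∉ S.erase (m u) := fun h => hxS (Finset.mem_of_mem_erase h)
  have hPDS : IsPDS G (insert x (S.erase (m u))) := by
    refine ⟨?_, fun v => if v = u then x else if v = x then u else m v, ?_⟩
    · intro v hv
      by_cases hvm : v = m u
      · refine ⟨u, ?_, ?_⟩
        · simp [hu, hmne.symm]
        · rw [hvm]; exact hadj.symm
      · have hvS : v ∉ S := by
          intro h
          apply hv
          simp [h, hvm]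
        by_contra hcon
        push Not at hcon
        have : v ∈ privates G S (m u) := by
          rw [mem_privates_aux]
          refine ⟨hvS, ?_⟩
          obtain ⟨w, hw, hvw⟩ := hdom v hvS
          have hall : ∀ y ∈ S, G.Adj v y → y = m u := by
            intro y hy hvy
            by_contra hne
            exact hcon y (by simp [hy, hne]) hvy
          ext y
          rw [mem_nbrS_aux, Finset.mem_singleton]
          constructor
          · rintro ⟨h1, h2⟩
            exact hall y h1 h2
          · rintro rfl
            refine ⟨hmS, ?_⟩
            rw [← hall w hw hvw]; exact hvw
        rw [hq] at this
        simp at this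
    · intro v hv
      by_cases hvu : v = u
      · subst hvu
        simp [hxnu, hxu.symm]
      · by_cases hvx : v = x
        · subst hvx
          simp [hvu, hxu, hu, hmne.symm, Ne.symm hvu]
        · have hvS : v ∈ S := by
            simp [hvx] at hv; exact hv.2
          have hvm : v ≠ m u := by
            simp [hvx] at hv; exact hv.1
          obtain ⟨a, b, c, d⟩ := hmatch v hvS
          have e1 : m v ≠ u := by
            intro h; apply hvm; rw [← h, d]
          have e2 : m v ≠ x := by
            intro h; apply hxS; rw [← h]; exact a
          have e3 : m v ≠ m u := by
            intro h; apply hvu; rw [← d, h, hmm]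
          simp [hvu, hvx, e1, e2, e3, a, b, c, d]
  have hcard : (insert x (S.erase (m u))).card = S.card := by
    rw [Finset.card_insert_of_notMem hxT, Finset.card_erase_add_one hmS]
  have h := hP1 _ hPDS hcard
  rw [lambdaS_insert_aux G _ _ hxT] at h
  have hS : lambdaS G S = lambdaS G (S.erase (m u)) + 2 * (nbrS G (S.erase (m u)) (m u)).card := by
    rw [← lambdaS_insert_aux G _ _ (Finset.notMem_erase _ _), Finset.insert_erase hmS]
  have e1 : nbrS G (S.erase (m u)) (m u) = nbrS G S (m u) := by
    ext y
    simp only [mem_nbrS_aux, Finset.mem_erase]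
    constructor
    · rintro ⟨⟨_, h⟩, h2⟩; exact ⟨h, h2⟩
    · rintro ⟨h, h2⟩; exact ⟨⟨h2.ne', h⟩, h2⟩
  have e2 : (nbrS G (S.erase (m u)) x).card ≤ 1 := by
    have : nbrS G (S.erase (m u)) x ⊆ nbrS G S x := by
      intro y
      simp only [mem_nbrS_aux, Finset.mem_erase]
      rintro ⟨⟨_, h⟩, h2⟩; exact ⟨h, h2⟩
    have := Finset.card_le_card this
    rw [hxN] at this
    simpa using this
  rw [e1] at hS
  omega

/-- Two adjacent `B`-vertices of distinct pairs: their mates share an exclusive neighbour. -/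
lemma exists_common_aux (S : Finset V) (m : V → V)
    (hdom : ∀ v : V, v ∉ S → ∃ u ∈ S, G.Adj v u)
    (hmatch : IsMatchingOn G S m)
    (hmincard : ∀ T : Finset V, IsPDS G T → S.card ≤ T.card)
    (u w : V) (hu : u ∈ S) (hw : w ∈ S) (hq : privates G S (m u) = ∅)
    (hq' : privates G S (m w) = ∅) (huw : G.Adj u w) (hne : w ≠ m u) :
    ∃ z, z ∉ S ∧ nbrS G S z = {m u, m w} := by
  by_contra hcon
  push Not at hcon
  obtain ⟨hmS, hmne, hadj, hmm⟩ := hmatch u hu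
  obtain ⟨hmS', hmne', hadj', hmm'⟩ := hmatch w hw
  have hune : u ≠ m w := by
    intro h; apply hne; rw [h, hmm']
  have huw' : u ≠ w := huw.ne
  have hPDS : IsPDS G ((S.erase (m u)).erase (m w)) := by
    refine ⟨?_, fun v => if v = u then w else if v = w then u else m v, ?_⟩
    · intro v hv
      by_cases hvm : v = m u
      · refine ⟨u, ?_, ?_⟩
        · simp [hu, hmne.symm, hune]
        · rw [hvm]; exact hadj.symm
      by_cases hvm' : v = m w
      · refine ⟨w, ?_, ?_⟩
        · simp [hw, hmne'.symm, hne]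
        · rw [hvm']; exact hadj'.symm
      have hvS : v ∉ S := by
        intro h
        apply hv
        simp [h, hvm, hvm']
      by_contra hcon2
      push Not at hcon2
      have hall : ∀ y ∈ S, G.Adj v y → y = m u ∨ y = m w := by
        intro y hy hvy
        by_contra hne
        push Not at hne
        exact hcon2 y (by simp [hy, hne]) hvy
      obtain ⟨t, ht, hvt⟩ := hdom v hvS
      by_cases a1 : G.Adj v (m u)
      · by_cases a2 : G.Adj v (m w)
        · apply hcon v hvS
          ext y
          simp only [mem_nbrS_aux, Finset.mem_insert, Finset.mem_singleton]
          constructor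
          · rintro ⟨h1, h2⟩
            exact hall y h1 h2
          · rintro (rfl | rfl)
            · exact ⟨hmS, a1⟩
            · exact ⟨hmS', a2⟩
        · have : v ∈ privates G S (m u) := by
            rw [mem_privates_aux]
            refine ⟨hvS, ?_⟩
            ext y
            rw [mem_nbrS_aux, Finset.mem_singleton]
            constructor
            · rintro ⟨h1, h2⟩
              rcases hall y h1 h2 with h | h
              · exact h
              · exact absurd (h ▸ h2) a2
            · rintro rfl
              exact ⟨hmS, a1⟩
          rw [hq] at this
          simp at this
      · have : v ∈ privates G S (m w) := by
          rw [mem_privates_aux]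
          refine ⟨hvS, ?_⟩
          have hall' : ∀ y ∈ S, G.Adj v y → y = m w := by
            intro y h1 h2
            rcases hall y h1 h2 with h | h
            · exact absurd (h ▸ h2) a1
            · exact h
          ext y
          rw [mem_nbrS_aux, Finset.mem_singleton]
          constructor
          · rintro ⟨h1, h2⟩
            exact hall' y h1 h2
          · rintro rfl
            refine ⟨hmS', ?_⟩
            rw [← hall' t ht hvt]; exact hvt
        rw [hq'] at this
        simp at this
    · intro v hv
      by_cases hvu : v = u
      · subst hvu
        simp [huw, hw, hne, hmne'.symm, huw'.symm]
      · by_cases hvx : v = w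
        · subst hvx
          simp [hvu, huw.symm, hu, hmne.symm, huw', hune]
        · simp only [Finset.mem_erase] at hv
          obtain ⟨hv1, hv2, hvS⟩ := hv
          obtain ⟨a, b, c, d⟩ := hmatch v hvS
          have e1 : m v ≠ u := by
            intro h; apply hv2; rw [← h, d]
          have e2 : m v ≠ w := by
            intro h; apply hv1; rw [← h, d]
          have e3 : m v ≠ m u := by
            intro h; apply hvu; rw [← d, h, hmm]
          have e4 : m v ≠ m w := by
            intro h; apply hvx; rw [← d, h, hmm']
          simp [hvu, hvx, e1, e2, e3, e4, a, b, c, d]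
  have h := hmincard _ hPDS
  have h1 : ((S.erase (m u)).erase (m w)).card ≤ (S.erase (m u)).card :=
    Finset.card_le_card (Finset.erase_subset _ _)
  have h2 := Finset.card_erase_lt_of_mem hmS
  omega

/-- The neighbours of `u` outside `S`. -/
def outN (S : Finset V) (u : V) : Finset V := (Finset.univ \ S).filter (fun x => G.Adj x u)

lemma card_out_in_aux (hcubic : ∀ v : V, G.degree v = 3) (S : Finset V) (u : V) :
    (outN G S u).card + (nbrS G S u).card = 3 := by
  rw [← hcubic u, ← G.card_neighborFinset_eq_degree,
    ← Finset.card_filter_add_card_filter_not (s := G.neighborFinset u) (fun x => x ∉ S)]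
  congr 2
  · ext x
    simp [outN, G.adj_comm, and_comm]
  · ext x
    simp [nbrS, and_comm]

lemma card_nbrS_le_aux (hcubic : ∀ v : V, G.degree v = 3) (S : Finset V) (u : V) :
    (nbrS G S u).card ≤ 3 := by
  have := card_out_in_aux G hcubic S u
  omega

lemma privates_subset_aux (S : Finset V) (u : V) : privates G S u ⊆ outN G S u := by
  intro x hx
  rw [mem_privates_aux] at hx
  have : u ∈ nbrS G S x := by rw [hx.2]; simp
  rw [mem_nbrS_aux] at this
  simp [outN, hx.1, this.2]

lemma gsum_aux (S : Finset V) (m : V → V) (u : V) :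
    ∑ x ∈ Finset.univ \ S, fwt G S m x u = ∑ x ∈ outN G S u, fwt G S m x u := by
  unfold outN
  rw [Finset.sum_filter]
  apply Finset.sum_congr rfl
  intro x _
  split_ifs with h
  · rfl
  · simp [fwt, h]

lemma fwt_private_aux (S : Finset V) (m : V → V) (u x : V) (hu : u ∈ S)
    (hx : x ∈ privates G S u) : fwt G S m x u = 1 := by
  rw [mem_privates_aux] at hx
  have : u ∈ nbrS G S x := by rw [hx.2]; simp
  rw [mem_nbrS_aux] at this
  simp [fwt, hx.1, hu, this.2, hx.2]

lemma fwt_nonneg_aux (hcubic : ∀ v : V, G.degree v = 3) (S : Finset V) (m : V → V) (u x : V) :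
    0 ≤ fwt G S m x u := by
  unfold fwt
  have h3 : (nbrS G S x ∩ (setB G S m ∪ setC G S m)).card ≤ 3 :=
    (Finset.card_le_card Finset.inter_subset_left).trans (card_nbrS_le_aux G hcubic S x)
  have h3' : ((nbrS G S x ∩ (setB G S m ∪ setC G S m)).card : ℚ) ≤ 3 := by exact_mod_cast h3
  split_ifs <;> try positivity
  apply div_nonneg
  · linarith
  · positivity

lemma fwt_ge_aux (hcubic : ∀ v : V, G.degree v = 3) (S : Finset V) (m : V → V) (u x : V)
    (hu : u ∈ S) (hA : u ∉ setA G S m) (hBC : u ∈ setB G S m ∪ setC G S m)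
    (hx : x ∈ outN G S u) : 1 / 6 ≤ fwt G S m x u := by
  simp only [outN, Finset.mem_filter, Finset.mem_sdiff, Finset.mem_univ, true_and] at hx
  have aux : ∀ T : Finset V, u ∈ T → T ⊆ nbrS G S x → (1 : ℚ) / 6 ≤ 1 / (T.card : ℚ) := by
    intro T hT hs
    have h3 : T.card ≤ 3 := (Finset.card_le_card hs).trans (card_nbrS_le_aux G hcubic S x)
    have h3' : (T.card : ℚ) ≤ 3 := by exact_mod_cast h3
    have h0 : (0 : ℚ) < T.card := by exact_mod_cast Finset.card_pos.2 ⟨u, hT⟩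
    apply one_div_le_one_div_of_le h0
    linarith
  have hmem : u ∈ nbrS G S x := by rw [mem_nbrS_aux]; exact ⟨hu, hx.2⟩
  unfold fwt
  rw [if_neg (by simp [hx.1, hu, hx.2])]
  split_ifs
  · norm_num
  · exact aux _ hmem (Finset.Subset.refl _)
  · exact aux _ (Finset.mem_inter.2 ⟨hmem, hBC⟩) Finset.inter_subset_left
  · norm_num

lemma gA_aux (hcubic : ∀ v : V, G.degree v = 3) (S : Finset V) (m : V → V) (u : V) (hu : u ∈ S) :
    ((privates G S u).card : ℚ) ≤ ∑ x ∈ outN G S u, fwt G S m x u := by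
  calc ((privates G S u).card : ℚ) = ∑ x ∈ privates G S u, fwt G S m x u := by
        rw [Finset.sum_congr rfl (fun x hx => fwt_private_aux G S m u x hu hx)]
        simp
    _ ≤ _ := Finset.sum_le_sum_of_subset_of_nonneg (privates_subset_aux G S u)
        (fun x _ _ => fwt_nonneg_aux G hcubic S m u x)

/-- A subset of weight `≥ c` plus `1/6` for each other edge. -/
lemma gBC_aux (hcubic : ∀ v : V, G.degree v = 3) (S : Finset V) (m : V → V) (u z : V)
    (hu : u ∈ S) (hA : u ∉ setA G S m) (hBC : u ∈ setB G S m ∪ setC G S m)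
    (hz : z ∈ outN G S u) :
    fwt G S m z u + (((outN G S u).card : ℚ) - 1) / 6 ≤ ∑ x ∈ outN G S u, fwt G S m x u := by
  rw [← Finset.add_sum_erase _ _ hz]
  have h : ((outN G S u).erase z).card • ((1 : ℚ) / 6)
      ≤ ∑ x ∈ (outN G S u).erase z, fwt G S m x u :=
    Finset.card_nsmul_le_sum _ _ _
      (fun x hx => fwt_ge_aux G hcubic S m u x hu hA hBC (Finset.mem_of_mem_erase hx))
  have hc : ((((outN G S u).erase z).card : ℕ) : ℚ) = ((outN G S u).card : ℚ) - 1 := by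
    have := Finset.card_erase_add_one hz
    rw [← this]; push_cast; ring
  rw [nsmul_eq_mul, hc] at h
  linarith

lemma gBC_aux' (hcubic : ∀ v : V, G.degree v = 3) (S : Finset V) (m : V → V) (u : V)
    (hu : u ∈ S) (hA : u ∉ setA G S m) (hBC : u ∈ setB G S m ∪ setC G S m) :
    ((outN G S u).card : ℚ) / 6 ≤ ∑ x ∈ outN G S u, fwt G S m x u := by
  have h : (outN G S u).card • ((1 : ℚ) / 6) ≤ ∑ x ∈ outN G S u, fwt G S m x u :=
    Finset.card_nsmul_le_sum _ _ _
      (fun x hx => fwt_ge_aux G hcubic S m u x hu hA hBC hx)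
  rw [nsmul_eq_mul] at h
  linarith

/-- Number of `A`-`B` transfers along an edge from `u` to `v`. -/
def trans1 (S : Finset V) (m : V → V) (u v : V) : ℚ :=
  if G.Adj u v ∧ u ∈ setA G S m ∧ v ∈ setB G S m \ setA G S m then 1 else 0

/-- Weight of `u` after discharging within `C`. -/
def gdis (S : Finset V) (m : V → V) (C : Finset V) (u : V) : ℚ :=
  ∑ x ∈ outN G S u, fwt G S m x u + (1 / 6) * ∑ v ∈ C, (trans1 G S m v u - trans1 G S m u v)

lemma trans1_nonneg_aux (S : Finset V) (m : V → V) (u v : V) : 0 ≤ trans1 G S m u v := by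
  unfold trans1; split_ifs <;> norm_num

lemma sum_gdis_aux (S : Finset V) (m : V → V) (C : Finset V) :
    ∑ u ∈ C, gdis G S m C u = fsum G S m C := by
  unfold gdis fsum
  simp only [gsum_aux]
  rw [Finset.sum_add_distrib, ← Finset.mul_sum]
  simp only [Finset.sum_sub_distrib]
  rw [Finset.sum_comm (f := fun u v => trans1 G S m v u)]
  simp

lemma gdis_nonA_aux (S : Finset V) (m : V → V) (C : Finset V) (u : V) (hA : u ∉ setA G S m) :
    ∑ x ∈ outN G S u, fwt G S m x u ≤ gdis G S m C u := by
  unfold gdis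
  have : 0 ≤ ∑ v ∈ C, (trans1 G S m v u - trans1 G S m u v) := by
    apply Finset.sum_nonneg
    intro v _
    have h := trans1_nonneg_aux G S m v u
    have h2 : trans1 G S m u v = 0 := by simp [trans1, hA]
    linarith
  linarith

lemma gdis_B_aux (S : Finset V) (m : V → V) (C : Finset V) (u w : V) (hA : u ∉ setA G S m)
    (hB : u ∈ setB G S m) (hw : w ∈ C) (hwA : w ∈ setA G S m) (h : G.Adj w u) :
    ∑ x ∈ outN G S u, fwt G S m x u + 1 / 6 ≤ gdis G S m C u := by
  unfold gdis
  have h2 : ∀ v, trans1 G S m u v = 0 := by intro v; simp [trans1, hA]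
  have h1 : trans1 G S m w u = 1 := by simp [trans1, hA, hB, hwA, h]
  have : trans1 G S m w u - trans1 G S m u w
      ≤ ∑ v ∈ C, (trans1 G S m v u - trans1 G S m u v) := by
    apply Finset.single_le_sum (f := fun v => trans1 G S m v u - trans1 G S m u v) _ hw
    intro v _
    have h := trans1_nonneg_aux G S m v u
    simp only [h2]
    linarith
  rw [h1, h2] at this
  linarith

lemma gdis_A_aux (hcubic : ∀ v : V, G.degree v = 3) (S : Finset V) (m : V → V)
    (hmatch : IsMatchingOn G S m) (C : Finset V) (hC : C ⊆ S) (u : V)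
    (hu : u ∈ S) (hmA : m u ∈ setA G S m) (hA : u ∈ setA G S m) :
    ((privates G S u).card : ℚ) - (2 - (privates G S u).card) / 6 ≤ gdis G S m C u := by
  have hg := gA_aux G hcubic S m u hu
  have h1 : ∑ v ∈ C, trans1 G S m u v ≤ 2 - ((privates G S u).card : ℚ) := by
    have e : ∑ v ∈ C, trans1 G S m u v ≤ (((nbrS G S u).erase (m u)).card : ℚ) := by
      unfold trans1
      rw [Finset.sum_boole]
      norm_cast
      apply Finset.card_le_card
      intro v hv
      simp only [Finset.mem_filter, Finset.mem_sdiff] at hv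
      rw [Finset.mem_erase, mem_nbrS_aux]
      refine ⟨?_, hC hv.1, hv.2.1⟩
      rintro rfl
      exact hv.2.2.2.2 hmA
    have hmem : m u ∈ nbrS G S u := by
      rw [mem_nbrS_aux]; exact ⟨(hmatch u hu).1, (hmatch u hu).2.2.1⟩
    have c1 := Finset.card_erase_add_one hmem
    have c2 := card_out_in_aux G hcubic S u
    have c3 := Finset.card_le_card (privates_subset_aux G S u)
    have c4 : ((nbrS G S u).erase (m u)).card + (privates G S u).card ≤ 2 := by omega
    have c5 : (((nbrS G S u).erase (m u)).card : ℚ) + (privates G S u).card ≤ 2 := by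
      exact_mod_cast c4
    linarith
  have h2 : 0 ≤ ∑ v ∈ C, trans1 G S m v u :=
    Finset.sum_nonneg (fun v _ => trans1_nonneg_aux G S m v u)
  unfold gdis
  rw [Finset.sum_sub_distrib]
  linarith

/-- The weight of a `BC`-pair after discharging. -/
lemma pairBC_aux (S : Finset V) (m : V → V)
    (hcubic : ∀ v : V, G.degree v = 3)
    (hdom : ∀ v : V, v ∉ S → ∃ u ∈ S, G.Adj v u)
    (hmatch : IsMatchingOn G S m)
    (hmincard : ∀ T : Finset V, IsPDS G T → S.card ≤ T.card)
    (hP1 : ∀ T : Finset V, IsPDS G T → T.card = S.card → lambdaS G S ≤ lambdaS G T)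
    (C : Finset V) (hCS : C ⊆ S) (hC : ∀ u ∈ C, ∀ v ∈ S, G.Adj u v → v ∈ C)
    (hD : ∀ u ∈ C, u ∉ setD G S m)
    (u : V) (hu : u ∈ C) (hA : u ∉ setA G S m) (hB : u ∈ setB G S m) :
    3 / 2 ≤ gdis G S m C u + gdis G S m C (m u) := by
  have huS := hCS hu
  obtain ⟨hmS, hmne, hadj, hmm⟩ := hmatch u huS
  have hpB : (privates G S u).Nonempty ∧ privates G S (m u) = ∅ := by
    simp only [setB, Finset.mem_filter] at hB; exact hB.2
  obtain ⟨⟨x, hx⟩, hq⟩ := hpB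
  have hmA : m u ∉ setA G S m := by
    simp only [setA, Finset.mem_filter, huS, hmS, true_and, hmm] at hA ⊢
    omega
  have hmC : m u ∈ setC G S m := by
    simp only [setC, Finset.mem_filter]; rw [hmm]; exact ⟨hmS, hB⟩
  have hBC : u ∈ setB G S m ∪ setC G S m := Finset.mem_union_left _ hB
  have hmBC : m u ∈ setB G S m ∪ setC G S m := Finset.mem_union_right _ hmC
  have hxo := privates_subset_aux G S u hx
  have g1 := gBC_aux G hcubic S m u x huS hA hBC hxo
  rw [fwt_private_aux G S m u x huS hx] at g1
  have g2 := gBC_aux' G hcubic S m (m u) hmS hmA hmBC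
  have d1 := gdis_nonA_aux G S m C u hA
  have d2 := gdis_nonA_aux G S m C (m u) hmA
  have hleaf := leaf_aux G S m hdom hmatch hP1 u huS ⟨x, hx⟩ hq
  have c1 := card_out_in_aux G hcubic S u
  have c2 := card_out_in_aux G hcubic S (m u)
  have o2 : 2 ≤ (outN G S (m u)).card := by omega
  have o2' : (2 : ℚ) ≤ ((outN G S (m u)).card : ℚ) := by exact_mod_cast o2
  have o1 : 1 ≤ (outN G S u).card := Finset.card_pos.2 ⟨x, hxo⟩
  have o1' : (1 : ℚ) ≤ ((outN G S u).card : ℚ) := by exact_mod_cast o1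
  by_cases o : 2 ≤ (outN G S u).card
  · have o' : (2 : ℚ) ≤ ((outN G S u).card : ℚ) := by exact_mod_cast o
    linarith
  have hn2 : 1 < (nbrS G S u).card := by omega
  obtain ⟨w, hw, hwm⟩ := Finset.exists_mem_ne hn2 (m u)
  rw [mem_nbrS_aux] at hw
  obtain ⟨hwS, huw⟩ := hw
  have hwC := hC u hu w hwS huw
  by_cases hwA : w ∈ setA G S m
  · have d3 := gdis_B_aux G S m C u w hA hB hwC hwA huw.symm
    linarith
  obtain ⟨hmwS, hmwne, hwadj, hmmw⟩ := hmatch w hwS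
  have hwB : privates G S (m w) = ∅ := by
    by_contra hne
    have hne' := Finset.nonempty_iff_ne_empty.2 hne
    have hpos := Finset.card_pos.2 hne'
    have hw0 : privates G S w = ∅ := by
      simp only [setA, Finset.mem_filter, hwS, true_and] at hwA
      rw [← Finset.card_eq_zero]; omega
    have hl := leaf_aux G S m hdom hmatch hP1 (m w) hmwS hne' (by rw [hmmw]; exact hw0)
    rw [hmmw, Finset.card_le_one] at hl
    have := hl u (by rw [mem_nbrS_aux]; exact ⟨huS, huw.symm⟩) (m w)
      (by rw [mem_nbrS_aux]; exact ⟨hmwS, hwadj⟩)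
    apply hwm
    rw [this, hmmw]
  have hwne : (privates G S w).Nonempty := by
    rw [Finset.nonempty_iff_ne_empty]
    intro h
    apply hD w hwC
    simp [setD, hwS, h, hwB]
  have hwBB : w ∈ setB G S m := by
    simp only [setB, Finset.mem_filter]; exact ⟨hwS, hwne, hwB⟩
  have hmwC : m w ∈ setC G S m := by
    simp only [setC, Finset.mem_filter]; rw [hmmw]; exact ⟨hmwS, hwBB⟩
  obtain ⟨z, hzS, hzN⟩ := exists_common_aux G S m hdom hmatch hmincard u w huS hwS hq hwB huw hwm
  have hmne2 : m u ≠ m w := by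
    intro h; apply huw.ne; rw [← hmm, h, hmmw]
  have hzadj : G.Adj z (m u) := ((mem_nbrS_aux G S z (m u)).1 (by rw [hzN]; simp)).2
  have hzo : z ∈ outN G S (m u) := by simp [outN, hzS, hzadj]
  have hf : fwt G S m z (m u) = 1 / 2 := by
    unfold fwt
    rw [if_neg (by simp [hzS, hmS, hzadj]), hzN, if_neg, if_pos]
    · rw [Finset.card_pair hmne2]; norm_num
    · right; left
      intro y hy
      simp only [Finset.mem_insert, Finset.mem_singleton] at hy
      rcases hy with rfl | rfl
      · exact hmBC
      · exact Finset.mem_union_right _ hmwC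
    · intro h
      have := congrArg Finset.card h
      rw [Finset.card_pair hmne2] at this
      simp at this
  have g3 := gBC_aux G hcubic S m (m u) z hmS hmA hmBC hzo
  rw [hf] at g3
  linarith

end Helpers

theorem component_without_D_pair_weight {V : Type*} [Fintype V] [DecidableEq V]
    (G : SimpleGraph V) [DecidableRel G.Adj] (S : Finset V) (m : V → V)
    (hconn : G.Connected)
    (hcubic : ∀ v : V, G.degree v = 3)
    (hdom : ∀ v : V, v ∉ S → ∃ u ∈ S, G.Adj v u)
    (hmatch : IsMatchingOn G S m)
    (hmincard : ∀ T : Finset V, IsPDS G T → S.card ≤ T.card)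
    (hP1 : ∀ T : Finset V, IsPDS G T → T.card = S.card → lambdaS G S ≤ lambdaS G T)
    (hP2 : ∀ (T : Finset V) (m' : V → V),
        (∀ v : V, v ∉ T → ∃ u ∈ T, G.Adj v u) → IsMatchingOn G T m' →
        T.card = S.card → lambdaS G T = lambdaS G S →
        (setA G S m ∪ setB G S m).card ≤ (setA G T m' ∪ setB G T m').card) :
    ∀ C : Finset V, IsComponent G S C →
      (¬ ∃ u ∈ C, IsDPair G S m u) →
      3 * (C.card : ℚ) / 4 ≤ fsum G S m C := by
  intro C hcomp hnoD
  obtain ⟨hCS, _, _, hC⟩ := hcomp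
  have hD : ∀ u ∈ C, u ∉ setD G S m := by
    intro u hu hd
    apply hnoD
    refine ⟨u, hu, hd, ?_⟩
    obtain ⟨h1, _, _, h4⟩ := hmatch u (hCS hu)
    simp only [setD, Finset.mem_filter] at hd ⊢
    rw [h4]
    exact ⟨h1, hd.2.2, hd.2.1⟩
  have hmC : ∀ u ∈ C, m u ∈ C := by
    intro u hu
    obtain ⟨h1, _, h3, _⟩ := hmatch u (hCS hu)
    exact hC u hu _ h1 h3
  have hpair : ∀ u ∈ C, 3 / 2 ≤ gdis G S m C u + gdis G S m C (m u) := by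
    intro u hu
    have huS := hCS hu
    obtain ⟨hmS, hmne, hadj, hmm⟩ := hmatch u huS
    by_cases hA : u ∈ setA G S m
    · have hmA : m u ∈ setA G S m := by
        simp only [setA, Finset.mem_filter, huS, hmS, true_and, hmm] at hA ⊢
        omega
      have h1 := gdis_A_aux G hcubic S m hmatch C hCS u huS hmA hA
      have h2 := gdis_A_aux G hcubic S m hmatch C hCS (m u) hmS (by rw [hmm]; exact hA) hmA
      have h3 : 2 ≤ (privates G S u).card + (privates G S (m u)).card := by
        simp only [setA, Finset.mem_filter] at hA; exact hA.2
      have h3' : (2 : ℚ) ≤ ((privates G S u).card : ℚ) + (privates G S (m u)).card := by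
        exact_mod_cast h3
      linarith
    · have hmA : m u ∉ setA G S m := by
        simp only [setA, Finset.mem_filter, huS, hmS, true_and, hmm] at hA ⊢
        omega
      have hle : (privates G S u).card + (privates G S (m u)).card ≤ 1 := by
        simp only [setA, Finset.mem_filter, huS, true_and] at hA
        omega
      by_cases hp : privates G S u = ∅
      · have hq : (privates G S (m u)).Nonempty := by
          rw [Finset.nonempty_iff_ne_empty]
          intro h
          apply hD u hu
          simp [setD, huS, hp, h]
        have hB : m u ∈ setB G S m := by
          simp only [setB, Finset.mem_filter]
          rw [hmm]; exact ⟨hmS, hq, hp⟩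
        have := pairBC_aux G S m hcubic hdom hmatch hmincard hP1 C hCS hC hD (m u) (hmC u hu)
          hmA hB
        rw [hmm] at this
        linarith
      · have hp' := Finset.nonempty_iff_ne_empty.2 hp
        have hpos := Finset.card_pos.2 hp'
        have hq : privates G S (m u) = ∅ := by
          rw [← Finset.card_eq_zero]; omega
        have hB : u ∈ setB G S m := by
          simp only [setB, Finset.mem_filter]
          exact ⟨huS, hp', hq⟩
        exact pairBC_aux G S m hcubic hdom hmatch hmincard hP1 C hCS hC hD u hu hA hB
  have hsum := Finset.card_nsmul_le_sum C _ _ hpair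
  rw [Finset.sum_add_distrib, nsmul_eq_mul] at hsum
  have hinv : ∑ u ∈ C, gdis G S m C (m u) = ∑ u ∈ C, gdis G S m C u := by
    apply Finset.sum_bij' (fun u _ => m u) (fun u _ => m u) hmC hmC
    · intro u hu; exact (hmatch u (hCS hu)).2.2.2
    · intro u hu; exact (hmatch u (hCS hu)).2.2.2
    · intro u _; rfl
  rw [hinv, sum_gdis_aux] at hsum
  linarith
end

section
/- Under the stated setup, there do not exist a D-pair S_u, a D-pair S_v and a BC-pair S_w with w ∈ B, pairwise distinct, such that uv ∈ E(G) and uw ∈ E(G). -/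
open Finset

/-- Adding a vertex `a` to `R` adds the edges from `a` into `R`. -/
lemma lambdaS_insert {V : Type*} [DecidableEq V] (G : SimpleGraph V) [DecidableRel G.Adj]
    (R : Finset V) (a : V) (ha : a ∉ R) :
    lambdaS G (insert a R) = lambdaS G R + 2 * (nbrS G R a).card := by
  have key : ∀ T : Finset V, lambdaS G T = ∑ p ∈ T, ∑ q ∈ T, if G.Adj p q then 1 else 0 := by
    intro T
    rw [lambdaS, Finset.card_filter, Finset.sum_product]
  have h1 : (nbrS G R a).card = ∑ q ∈ R, if G.Adj a q then 1 else 0 := by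
    rw [nbrS, Finset.card_filter]
  have h2 : (nbrS G R a).card = ∑ q ∈ R, if G.Adj q a then 1 else 0 := by
    rw [h1]
    exact Finset.sum_congr rfl fun q _ => by simp only [G.adj_comm]
  rw [key, key, Finset.sum_insert ha, Finset.sum_insert ha]
  simp only [Finset.sum_insert ha, Finset.sum_add_distrib]
  rw [← h1, ← h2]
  simp
  ring

theorem no_D_pair_adjacent_to_D_pair_and_BC_pair {V : Type*} [Fintype V] [DecidableEq V]
    (G : SimpleGraph V) [DecidableRel G.Adj] (S : Finset V) (m : V → V)
    (hconn : G.Connected)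
    (hcubic : ∀ v : V, G.degree v = 3)
    (hdom : ∀ v : V, v ∉ S → ∃ u ∈ S, G.Adj v u)
    (hmatch : IsMatchingOn G S m)
    (hmincard : ∀ T : Finset V, IsPDS G T → S.card ≤ T.card)
    (hP1 : ∀ T : Finset V, IsPDS G T → T.card = S.card → lambdaS G S ≤ lambdaS G T)
    (hP2 : ∀ (T : Finset V) (m' : V → V),
        (∀ v : V, v ∉ T → ∃ u ∈ T, G.Adj v u) → IsMatchingOn G T m' →
        T.card = S.card → lambdaS G T = lambdaS G S →
        (setA G S m ∪ setB G S m).card ≤ (setA G T m' ∪ setB G T m').card) :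
    ¬ ∃ u v w : V, IsDPair G S m u ∧ IsDPair G S m v ∧
      (w ∈ setB G S m ∧ m w ∈ setC G S m) ∧
      v ≠ u ∧ v ≠ m u ∧ w ≠ u ∧ w ≠ m u ∧ w ≠ v ∧ w ≠ m v ∧
      G.Adj u v ∧ G.Adj u w := by
  rintro ⟨u, v, w, ⟨huD, -⟩, ⟨hvD, -⟩, ⟨hwB, -⟩, hvu, hvmu, hwu, hwmu, hwv, -, huv, huw⟩
  simp only [setD, setB, Finset.mem_filter] at huD hvD hwB
  obtain ⟨huS, -, -⟩ := huD
  obtain ⟨hvS, -⟩ := hvD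
  obtain ⟨hwS, -, hpw⟩ := hwB
  obtain ⟨huS', hune, huadj, hum⟩ := hmatch u huS
  obtain ⟨hwS', hwne, hwadj, hwm⟩ := hmatch w hwS
  obtain ⟨x, hxS, hxu, hxN⟩ : ∃ x, x ∉ S ∧ G.Adj x (m u) ∧
      ∀ y ∈ S, G.Adj x y → y = m u ∨ y = m w := by
    by_contra hno
    push Not at hno
    have hmw : m w ≠ m u := fun h => hwu (by rw [← hwm, h, hum])
    have huw' : u ≠ m w := fun h => hwmu (by rw [h, hwm])
    have hpds : IsPDS G ((S.erase (m u)).erase (m w)) := by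
      refine ⟨?_, fun y => if y = u then w else if y = w then u else m y, ?_⟩
      · intro z hz
        by_contra hcon
        push Not at hcon
        have hcon' : ∀ y ∈ S, y ≠ m u → y ≠ m w → ¬ G.Adj z y := fun y h1 h2 h3 =>
          hcon y (by simp [h1, h2, h3])
        have hzu : z ≠ m u := by
          rintro rfl
          exact hcon' u huS hune.symm huw' huadj.symm
        have hzw : z ≠ m w := by
          rintro rfl
          exact hcon' w hwS hwmu hwne.symm hwadj.symm
        have hzS : z ∉ S := fun h => hz (by simp [h, hzu, hzw])
        have hzmu : ¬ G.Adj z (m u) := by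
          intro h
          obtain ⟨y, hy, hzy, h1, h2⟩ := hno z hzS h
          exact hcon' y hy h1 h2 hzy
        obtain ⟨y, hy, hzy⟩ := hdom z hzS
        have hall : ∀ y ∈ S, G.Adj z y → y = m w := by
          intro y hy hzy
          by_contra h2
          refine hcon' y hy ?_ h2 hzy
          rintro rfl
          exact hzmu hzy
        have hzpriv : z ∈ privates G S (m w) := by
          refine Finset.mem_filter.2 ⟨Finset.mem_univ z, hzS, ?_⟩
          ext t
          simp only [nbrS, Finset.mem_filter, Finset.mem_singleton]
          constructor
          · rintro ⟨h1, h2⟩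
            exact hall t h1 h2
          · rintro rfl
            exact ⟨hwS', hall y hy hzy ▸ hzy⟩
        rw [hpw] at hzpriv
        simp at hzpriv
      · intro y hy
        simp only [Finset.mem_erase] at hy ⊢
        obtain ⟨hy1, hy2, hyS⟩ := hy
        obtain ⟨a1, a2, a3, a4⟩ := hmatch y hyS
        have := huw.symm
        have := hwne.symm
        have := hune.symm
        have hwu' := Ne.symm hwu
        by_cases hyu : y = u
        · subst hyu
          simp_all
        by_cases hyw : y = w
        · subst hyw
          have hwu2 : ¬ u = y := hwu'
          simp [hwu, hwu2, this, huw', hune.symm, huS, huw.symm]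
        have b1 : m y ≠ u := fun h => hy2 (by rw [← a4, h])
        have b2 : m y ≠ w := fun h => hy1 (by rw [← a4, h])
        have b3 : m y ≠ m u := fun h => hyu (by rw [← a4, h, hum])
        have b4 : m y ≠ m w := fun h => hyw (by rw [← a4, h, hwm])
        simp [hyu, hyw, b1, b2, b3, b4, a1, a2, a3, a4]
    have hle := hmincard _ hpds
    have hlt : ((S.erase (m u)).erase (m w)).card < S.card :=
      lt_of_le_of_lt Finset.card_erase_le (Finset.card_erase_lt_of_mem huS')
    omega
  have hxR : x ∉ S.erase u := fun h => hxS (Finset.mem_of_mem_erase h)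
  have hxune : x ≠ u := fun h => hxS (h ▸ huS)
  have hxmu : x ≠ m u := fun h => hxS (h ▸ huS')
  have hsub : ({m u, v, w} : Finset V) ⊆ G.neighborFinset u := by
    intro y hy
    simp only [Finset.mem_insert, Finset.mem_singleton] at hy
    rw [SimpleGraph.mem_neighborFinset]
    rcases hy with rfl | rfl | rfl <;> assumption
  have hc3 : ({m u, v, w} : Finset V).card = 3 :=
    Finset.card_eq_three.2 ⟨_, _, _, hvmu.symm, hwmu.symm, hwv.symm, rfl⟩
  have hNu : ({m u, v, w} : Finset V) = G.neighborFinset u :=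
    Finset.eq_of_subset_of_card_le hsub (by
      rw [hc3, SimpleGraph.card_neighborFinset_eq_degree, hcubic])
  have hNuS : ∀ y, G.Adj u y → y ∈ S := by
    intro y hy
    have : y ∈ ({m u, v, w} : Finset V) := by
      rw [hNu, SimpleGraph.mem_neighborFinset]; exact hy
    simp only [Finset.mem_insert, Finset.mem_singleton] at this
    rcases this with rfl | rfl | rfl <;> assumption
  have hpds : IsPDS G (insert x (S.erase u)) := by
    refine ⟨?_, fun y => if y = x then m u else if y = m u then x else m y, ?_⟩
    · intro z hz
      by_cases hzu : z = u
      · subst hzu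
        exact ⟨v, by simp [hvS, hvu], huv⟩
      have hzS : z ∉ S := fun h => hz (by simp [h, hzu])
      obtain ⟨y, hy, hzy⟩ := hdom z hzS
      refine ⟨y, ?_, hzy⟩
      have hyu : y ≠ u := by
        rintro rfl
        exact hzS (hNuS z hzy.symm)
      simp [hy, hyu]
    · intro y hy
      by_cases hyx : y = x
      · subst hyx
        simp [hxmu.symm, huS', hune, hxu]
      have hyR : y ≠ u ∧ y ∈ S := by simpa [hyx] using hy
      obtain ⟨hyu, hyS⟩ := hyR
      by_cases hymu : y = m u
      · subst hymu
        simp [hxmu, hxmu.symm, hxu.symm]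
      obtain ⟨a1, a2, a3, a4⟩ := hmatch y hyS
      have b1 : m y ≠ u := fun h => hymu (by rw [← a4, h])
      have b2 : m y ≠ m u := fun h => hyu (by rw [← a4, h, hum])
      have b3 : m y ≠ x := fun h => hxS (h ▸ a1)
      simp [hyx, hymu, b1, b2, b3, a1, a2, a3, a4]
  have hcard : (insert x (S.erase u)).card = S.card := by
    rw [Finset.card_insert_of_notMem hxR, Finset.card_erase_add_one huS]
  have hle := hP1 _ hpds hcard
  have e1 := lambdaS_insert G (S.erase u) u (Finset.notMem_erase u S)
  rw [Finset.insert_erase huS] at e1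
  have e2 := lambdaS_insert G (S.erase u) x hxR
  have c1 : 3 ≤ (nbrS G (S.erase u) u).card := by
    rw [← hc3]
    apply Finset.card_le_card
    intro y hy
    have hy' : G.Adj u y := by simpa using hsub hy
    simp [nbrS, hy', hNuS y hy', hy'.ne']
  have c2 : (nbrS G (S.erase u) x).card ≤ 2 := by
    refine le_trans (Finset.card_le_card (t := {m u, m w}) ?_) Finset.card_le_two
    intro y hy
    simp only [nbrS, Finset.mem_filter, Finset.mem_erase] at hy
    simpa using hxN y hy.1.2 hy.2
  omega
end

section
/- Under the stated setup, let S_u and S_v be distinct D-pairs with uv ∈ E(G). If u has a neighbor r ∈ V∖S which has a neighbor w ∈ (B∪D)∖(S_u∪S_v), then there exists a vertex t₁ ∈ V∖S such that N_S(t₁) ⊆ {ū, v, w̄}. -/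
open Finset

theorem linked_D_pairs_neighbor {V : Type*} [Fintype V] [DecidableEq V]
    (G : SimpleGraph V) [DecidableRel G.Adj] (S : Finset V) (m : V → V)
    (hconn : G.Connected)
    (hcubic : ∀ v : V, G.degree v = 3)
    (hdom : ∀ v : V, v ∉ S → ∃ u ∈ S, G.Adj v u)
    (hmatch : IsMatchingOn G S m)
    (hmincard : ∀ T : Finset V, IsPDS G T → S.card ≤ T.card)
    (hP1 : ∀ T : Finset V, IsPDS G T → T.card = S.card → lambdaS G S ≤ lambdaS G T)
    (hP2 : ∀ (T : Finset V) (m' : V → V),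
        (∀ v : V, v ∉ T → ∃ u ∈ T, G.Adj v u) → IsMatchingOn G T m' →
        T.card = S.card → lambdaS G T = lambdaS G S →
        (setA G S m ∪ setB G S m).card ≤ (setA G T m' ∪ setB G T m').card) :
    ∀ u v r w : V,
      IsDPair G S m u → IsDPair G S m v → v ≠ u → v ≠ m u → G.Adj u v →
      r ∉ S → G.Adj u r → G.Adj r w →
      w ∈ setB G S m ∪ setD G S m →
      w ≠ u → w ≠ m u → w ≠ v → w ≠ m v →
      ∃ t₁ : V, t₁ ∉ S ∧ nbrS G S t₁ ⊆ {m u, v, m w} := by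
  intro u v r w hu hv hvu hvmu huv hr hur hrw hw hwu hwmu hwv hwmv
  have huS : u ∈ S := (Finset.mem_filter.mp hu.1).1
  have hvS : v ∈ S := (Finset.mem_filter.mp hv.1).1
  have hpu : privates G S (m u) = ∅ := (Finset.mem_filter.mp hu.1).2.2
  have hpv : privates G S (m v) = ∅ := (Finset.mem_filter.mp hv.1).2.2
  have hwS : w ∈ S := by
    rcases Finset.mem_union.mp hw with h | h
    · exact (Finset.mem_filter.mp h).1
    · exact (Finset.mem_filter.mp h).1
  obtain ⟨hmuS, hmu1, hmu2, hmu3⟩ := hmatch u huS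
  obtain ⟨hmvS, hmv1, hmv2, hmv3⟩ := hmatch v hvS
  obtain ⟨hmwS, hmw1, hmw2, hmw3⟩ := hmatch w hwS
  have e1 : m v ≠ u := fun h => hvmu (by rw [← h, hmv3])
  have e2 : m v ≠ m u := fun h => hvu (by rw [← hmv3, h, hmu3])
  have e3 : m w ≠ u := fun h => hwmu (by rw [← h, hmw3])
  have e4 : m w ≠ m u := fun h => hwu (by rw [← hmw3, h, hmu3])
  have e5 : m w ≠ v := fun h => hwmv (by rw [← h, hmw3])
  have e6 : m w ≠ m v := fun h => hwv (by rw [← hmw3, h, hmv3])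
  have hmS : ∀ z ∈ S, m z ∈ S ∧ m z ≠ z ∧ G.Adj z (m z) ∧ m (m z) = z := hmatch
  -- the neighbours of u
  have hnu : ∀ z, G.Adj u z → z = m u ∨ z = v ∨ z = r := by
    have hsub : ({m u, v, r} : Finset V) ⊆ G.neighborFinset u := by
      intro z hz
      simp only [Finset.mem_insert, Finset.mem_singleton] at hz
      rw [SimpleGraph.mem_neighborFinset]
      rcases hz with rfl | rfl | rfl <;> assumption
    have hc : ({m u, v, r} : Finset V).card = 3 := by
      rw [Finset.card_eq_three]
      exact ⟨m u, v, r, fun h => hvmu h.symm, fun h => hr (h ▸ hmuS), fun h => hr (h ▸ hvS), rfl⟩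
    have heq := Finset.eq_of_subset_of_card_le hsub
      (by rw [hc, SimpleGraph.card_neighborFinset_eq_degree, hcubic u])
    intro z hz
    have : z ∈ ({m u, v, r} : Finset V) := by
      rw [heq, SimpleGraph.mem_neighborFinset]; exact hz
    simpa using this
  -- step 1: a common neighbour t of m u and m v
  have step1 : ∃ t, t ∉ S ∧ nbrS G S t = {m u, m v} := by
    by_contra hno
    have hno2 : ∀ t, t ∉ S → ∃ z ∈ S, G.Adj t z ∧ z ≠ m u ∧ z ≠ m v := by
      intro t ht
      by_contra hcon
      have hsub : ∀ z ∈ S, G.Adj t z → z = m u ∨ z = m v := by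
        intro z hz hz2
        by_contra h
        push Not at h
        exact hcon ⟨z, hz, hz2, h.1, h.2⟩
      obtain ⟨z0, hz0, hz1⟩ := hdom t ht
      have key : ∀ a b, privates G S a = ∅ → (∀ z ∈ S, G.Adj t z → z = a ∨ z = b) →
          G.Adj t a → a ∈ S → G.Adj t b := by
        intro a b hp hs hta ha
        by_contra hb
        have : t ∈ privates G S a := by
          simp only [privates, Finset.mem_filter, Finset.mem_univ, true_and]
          refine ⟨ht, ?_⟩
          ext z
          simp only [nbrS, Finset.mem_filter, Finset.mem_singleton]
          constructor
          · rintro ⟨h1, h2⟩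
            rcases hs z h1 h2 with h | h
            · exact h
            · exact absurd (h ▸ h2) hb
          · rintro rfl
            exact ⟨ha, hta⟩
        rw [hp] at this
        simp at this
      have hboth : G.Adj t (m u) ∧ G.Adj t (m v) := by
        rcases hsub z0 hz0 hz1 with h | h
        · subst h
          exact ⟨hz1, key _ _ hpu hsub hz1 hmuS⟩
        · subst h
          exact ⟨key _ _ hpv (fun z a b => (hsub z a b).symm) hz1 hmvS, hz1⟩
      apply hno
      refine ⟨t, ht, ?_⟩
      ext z
      simp only [nbrS, Finset.mem_filter, Finset.mem_singleton, Finset.mem_insert]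
      constructor
      · rintro ⟨h1, h2⟩
        exact hsub z h1 h2
      · rintro (rfl | rfl)
        · exact ⟨hmuS, hboth.1⟩
        · exact ⟨hmvS, hboth.2⟩
    have hpds : IsPDS G ((S.erase (m u)).erase (m v)) := by
      constructor
      · intro x hx
        by_cases hxS : x ∈ S
        · have : x = m u ∨ x = m v := by
            simp only [Finset.mem_erase] at hx
            tauto
          rcases this with rfl | rfl
          · exact ⟨u, by simp only [Finset.mem_erase]; exact ⟨e1.symm, hmu1.symm, huS⟩, hmu2.symm⟩
          · exact ⟨v, by simp only [Finset.mem_erase]; exact ⟨hmv1.symm, hvmu, hvS⟩, hmv2.symm⟩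
        · obtain ⟨z, h1, h2, h3, h4⟩ := hno2 x hxS
          exact ⟨z, by simp only [Finset.mem_erase]; exact ⟨h4, h3, h1⟩, h2⟩
      · refine ⟨fun z => if z = u then v else if z = v then u else m z, ?_⟩
        intro z hz
        simp only [Finset.mem_erase] at hz ⊢
        obtain ⟨hz1, hz2, hz3⟩ := hz
        by_cases h1 : z = u
        · subst h1
          simp only [if_true, if_neg hvu]
          exact ⟨⟨hmv1.symm, hvmu, hvS⟩, hvu, huv, trivial⟩
        · by_cases h2 : z = v
          · subst h2
            simp only [if_true, if_neg h1]
            exact ⟨⟨e1.symm, hmu1.symm, huS⟩, hvu.symm, huv.symm, trivial⟩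
          · obtain ⟨g1, g2, g3, g4⟩ := hmS z hz3
            have k1 : m z ≠ u := fun h => hz2 (by rw [← h, g4])
            have k2 : m z ≠ v := fun h => hz1 (by rw [← h, g4])
            have k3 : m z ≠ m u := fun h => h1 (by rw [← g4, h, hmu3])
            have k4 : m z ≠ m v := fun h => h2 (by rw [← g4, h, hmv3])
            simp only [if_neg h1, if_neg h2, if_neg k1, if_neg k2]
            exact ⟨⟨k4, k3, g1⟩, g2, g3, g4⟩
    have h1 := hmincard _ hpds
    have h2 : ((S.erase (m u)).erase (m v)).card < S.card :=
      Finset.card_lt_card (Finset.ssubset_iff_subset_ne.mpr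
        ⟨(Finset.erase_subset _ _).trans (Finset.erase_subset _ _), fun h => by
          have : m v ∈ (S.erase (m u)).erase (m v) := by rw [h]; exact hmvS
          simp at this⟩)
    omega
  obtain ⟨t, ht, hnt⟩ := step1
  have htmem : ∀ z, z ∈ S ∧ G.Adj t z ↔ z = m u ∨ z = m v := by
    intro z
    have := Finset.ext_iff.mp hnt z
    simpa [nbrS] using this
  have htu : G.Adj t (m u) := ((htmem (m u)).2 (Or.inl rfl)).2
  have htv : G.Adj t (m v) := ((htmem (m v)).2 (Or.inr rfl)).2
  have htr : t ≠ r := by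
    rintro rfl
    rcases (htmem w).1 ⟨hwS, hrw⟩ with h | h
    · exact hwmu h
    · exact hwmv h
  -- step 2
  by_contra hno
  have hno2 : ∀ x, x ∉ S → x ≠ r → ∃ z ∈ S, G.Adj x z ∧ z ≠ u ∧ z ≠ m u ∧ z ≠ v ∧ z ≠ m w := by
    intro x hx hxr
    by_contra hcon
    apply hno
    refine ⟨x, hx, ?_⟩
    intro z hz
    simp only [nbrS, Finset.mem_filter] at hz
    simp only [Finset.mem_insert, Finset.mem_singleton]
    by_contra h
    push Not at h
    refine hcon ⟨z, hz.1, hz.2, ?_, h.1, h.2.1, h.2.2⟩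
    rintro rfl
    rcases hnu x hz.2.symm with h | h | h
    · exact hx (h ▸ hmuS)
    · exact hx (h ▸ hvS)
    · exact hxr h
  have hPS : ({u, m u, v, m w} : Finset V) ⊆ S := by
    intro z hz
    simp only [Finset.mem_insert, Finset.mem_singleton] at hz
    rcases hz with rfl | rfl | rfl | rfl <;> assumption
  have hPc : ({u, m u, v, m w} : Finset V).card = 4 := by
    rw [Finset.card_insert_of_notMem, Finset.card_insert_of_notMem, Finset.card_pair e5.symm]
    · simp only [Finset.mem_insert, Finset.mem_singleton]
      rintro (h | h)
      · exact hvmu h.symm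
      · exact e4 h.symm
    · simp only [Finset.mem_insert, Finset.mem_singleton]
      rintro (h | h | h)
      · exact hmu1 h.symm
      · exact hvu h.symm
      · exact e3 h.symm
  set T : Finset V := insert r (insert t (S \ {u, m u, v, m w})) with hT
  have hTmem : ∀ z, z ∈ T ↔ z = r ∨ z = t ∨ (z ∈ S ∧ z ≠ u ∧ z ≠ m u ∧ z ≠ v ∧ z ≠ m w) := by
    intro z
    simp [hT]
  have hrT : r ∈ T := (hTmem r).2 (Or.inl rfl)
  have htT : t ∈ T := (hTmem t).2 (Or.inr (Or.inl rfl))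
  have hmvT : m v ∈ T := (hTmem _).2 (Or.inr (Or.inr ⟨hmvS, e1, e2, hmv1, e6.symm⟩))
  have hwT : w ∈ T := (hTmem _).2 (Or.inr (Or.inr ⟨hwS, hwu, hwmu, hwv, hmw1.symm⟩))
  have hTcard : T.card < S.card := by
    have h1 : T.card ≤ (S \ {u, m u, v, m w}).card + 1 + 1 :=
      (Finset.card_insert_le _ _).trans (Nat.add_le_add_right (Finset.card_insert_le _ _) 1)
    have h2 := Finset.card_sdiff_add_card_eq_card hPS
    omega
  have hTpds : IsPDS G T := by
    constructor
    · intro x hx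
      by_cases hxS : x ∈ S
      · have : x = u ∨ x = m u ∨ x = v ∨ x = m w := by
          by_contra h
          push Not at h
          exact hx ((hTmem x).2 (Or.inr (Or.inr ⟨hxS, h⟩)))
        rcases this with rfl | rfl | rfl | rfl
        · exact ⟨r, hrT, hur⟩
        · exact ⟨t, htT, htu.symm⟩
        · exact ⟨_, hmvT, hmv2⟩
        · exact ⟨w, hwT, hmw2.symm⟩
      · have hxr : x ≠ r := fun h => hx (h ▸ hrT)
        obtain ⟨z, h1, h2, h3⟩ := hno2 x hxS hxr
        exact ⟨z, (hTmem z).2 (Or.inr (Or.inr ⟨h1, h3⟩)), h2⟩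
    · have a1 : m v ≠ r := fun h => hr (h ▸ hmvS)
      have a2 : m v ≠ t := fun h => ht (h ▸ hmvS)
      have a3 : w ≠ r := fun h => hr (h ▸ hwS)
      have a4 : w ≠ t := fun h => ht (h ▸ hwS)
      refine ⟨fun z => if z = r then w else if z = w then r else if z = t then m v
        else if z = m v then t else m z, ?_⟩
      intro z hz
      by_cases b1 : z = r
      · subst b1
        simp only [if_true, if_neg a3]
        exact ⟨hwT, a3, hrw, trivial⟩
      by_cases b2 : z = w
      · subst b2
        simp only [if_true, if_neg b1]
        exact ⟨hrT, a3.symm, hrw.symm, trivial⟩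
      by_cases b3 : z = t
      · subst b3
        simp only [if_true, if_neg b1, if_neg b2, if_neg a1, if_neg a2, if_neg hwmv.symm]
        exact ⟨hmvT, a2, htv, trivial⟩
      by_cases b4 : z = m v
      · subst b4
        simp only [if_true, if_neg b1, if_neg b2, if_neg b3, if_neg htr, if_neg a4.symm]
        exact ⟨htT, a2.symm, htv.symm, trivial⟩
      obtain ⟨hzS, c1, c2, c3, c4⟩ : z ∈ S ∧ z ≠ u ∧ z ≠ m u ∧ z ≠ v ∧ z ≠ m w := by
        rcases (hTmem z).1 hz with h | h | h
        · exact absurd h b1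
        · exact absurd h b3
        · exact h
      obtain ⟨g1, g2, g3, g4⟩ := hmS z hzS
      have d1 : m z ≠ r := fun h => hr (h ▸ g1)
      have d2 : m z ≠ t := fun h => ht (h ▸ g1)
      have d3 : m z ≠ w := fun h => c4 (by rw [← h, g4])
      have d4 : m z ≠ m v := fun h => c3 (by rw [← g4, h, hmv3])
      have d5 : m z ≠ u := fun h => c2 (by rw [← h, g4])
      have d6 : m z ≠ m u := fun h => c1 (by rw [← g4, h, hmu3])
      have d7 : m z ≠ v := fun h => b4 (by rw [← h, g4])
      have d8 : m z ≠ m w := fun h => b2 (by rw [← g4, h, hmw3])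
      simp only [if_neg b1, if_neg b2, if_neg b3, if_neg b4, if_neg d1, if_neg d2, if_neg d3,
        if_neg d4]
      exact ⟨(hTmem _).2 (Or.inr (Or.inr ⟨g1, d5, d6, d7, d8⟩)), g2, g3, g4⟩
  have := hmincard T hTpds
  omega
end
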